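/- arXiv:2202.08111 — 5 statements merged into one kernel-verified Lean document; each statement's English description precedes it below -/
import Mathlib

section
/- Transport of the Riemann invariants along characteristics: Let U ⊆ ℝ² be open and let ρ, w : U → ℝ be C¹ with ρ > 0 on U, satisfying the Euler equations ∂_t ρ + ∂_x(ρw) = 0 and ∂_t w + w ∂_x w = −(1/ρ) ∂_x p(ρ) on U. Then the Riemann invariants α = σ(ρ) + w and β = σ(ρ) − w satisfy ∂_t α + (w + η(ρ)) ∂_x α = 0 and ∂_t β + (w − η(ρ)) ∂_x β = 0 on U. -/
noncomputable section

open Set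

/-- Partial derivative with respect to time `t` (the first coordinate). -/
def pt (f : ℝ × ℝ → ℝ) (q : ℝ × ℝ) : ℝ := deriv (fun s => f (s, q.2)) q.1

/-- Partial derivative with respect to space `x` (the second coordinate). -/
def px (f : ℝ × ℝ → ℝ) (q : ℝ × ℝ) : ℝ := deriv (fun s => f (q.1, s)) q.2

theorem hasDerivAt_pt {f : ℝ × ℝ → ℝ} {q : ℝ × ℝ} (hf : DifferentiableAt ℝ f q) :
    HasDerivAt (fun s => f (s, q.2)) (pt f q) q.1 :=
  (DifferentiableAt.comp (f := fun s : ℝ => (s, q.2)) q.1 hf (by fun_prop)).hasDerivAt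

theorem hasDerivAt_px {f : ℝ × ℝ → ℝ} {q : ℝ × ℝ} (hf : DifferentiableAt ℝ f q) :
    HasDerivAt (fun s => f (q.1, s)) (px f q) q.2 :=
  (DifferentiableAt.comp (f := fun s : ℝ => (q.1, s)) q.2 hf (by fun_prop)).hasDerivAt

/-- **Transport of the Riemann invariants along characteristics.**
Let `U ⊆ ℝ²` be open and `ρ, w : U → ℝ` be `C¹` with `ρ > 0` on `U`, satisfying the barotropic
Euler equations `∂_t ρ + ∂_x(ρw) = 0`, `∂_t w + w ∂_x w = −(1/ρ) ∂_x p(ρ)` on `U`.  With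
the sound speed `η(ρ) = √(p′(ρ))` and `σ` a primitive of `η(ρ)/ρ`, the Riemann invariants
`α = σ(ρ) + w` and `β = σ(ρ) − w` satisfy
`∂_t α + (w + η(ρ)) ∂_x α = 0` and `∂_t β + (w − η(ρ)) ∂_x β = 0` on `U`. -/
theorem riemann_invariants_transport
    (p η σ : ℝ → ℝ)
    (hp : ContDiffOn ℝ (⊤ : ℕ∞) p (Ioi 0))
    (hp' : ∀ r > (0 : ℝ), 0 < deriv p r)
    (hη : ∀ r > (0 : ℝ), η r = Real.sqrt (deriv p r))
    (hσ : ∀ r > (0 : ℝ), HasDerivAt σ (η r / r) r)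
    (U : Set (ℝ × ℝ)) (hU : IsOpen U)
    (ρ w : ℝ × ℝ → ℝ)
    (hρ : ContDiffOn ℝ 1 ρ U) (hw : ContDiffOn ℝ 1 w U)
    (hρpos : ∀ q ∈ U, 0 < ρ q)
    (hmass : ∀ q ∈ U, pt ρ q + px (fun q' => ρ q' * w q') q = 0)
    (hmom : ∀ q ∈ U,
      pt w q + w q * px w q = -(1 / ρ q) * px (fun q' => p (ρ q')) q) :
    ∀ q ∈ U,
      (pt (fun q' => σ (ρ q') + w q') q
          + (w q + η (ρ q)) * px (fun q' => σ (ρ q') + w q') q = 0) ∧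
      (pt (fun q' => σ (ρ q') - w q') q
          + (w q - η (ρ q)) * px (fun q' => σ (ρ q') - w q') q = 0) := by
  intro q hq
  have hr := hρpos q hq
  have hρd : DifferentiableAt ℝ ρ q :=
    (hρ.contDiffAt (hU.mem_nhds hq)).differentiableAt one_ne_zero
  have hwd : DifferentiableAt ℝ w q :=
    (hw.contDiffAt (hU.mem_nhds hq)).differentiableAt one_ne_zero
  have hpd : HasDerivAt p (deriv p (ρ q)) (ρ q) :=
    ((hp.contDiffAt (Ioi_mem_nhds hr)).differentiableAt (by simp)).hasDerivAt
  have hσd := hσ (ρ q) hr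
  have hρt := hasDerivAt_pt hρd
  have hρx := hasDerivAt_px hρd
  have hwt := hasDerivAt_pt hwd
  have hwx := hasDerivAt_px hwd
  have hσt := hσd.comp q.1 hρt
  have hσx := hσd.comp q.2 hρx
  have hmass_q := hmass q hq
  have hmom_q := hmom q hq
  rw [show px (fun q' => ρ q' * w q') q = px ρ q * w q + ρ q * px w q from
    (hρx.mul hwx).deriv] at hmass_q
  rw [show px (fun q' => p (ρ q')) q = η (ρ q) ^ 2 * px ρ q by
    rw [hη _ hr, Real.sq_sqrt (hp' _ hr).le]
    exact (hpd.comp q.2 hρx).deriv] at hmom_q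
  have hρt_eq : pt ρ q = -(px ρ q * w q + ρ q * px w q) := by linarith
  have hwt_eq : pt w q = -(1 / ρ q) * (η (ρ q) ^ 2 * px ρ q) - w q * px w q := by linarith
  constructor
  · rw [show pt (fun q' => σ (ρ q') + w q') q = η (ρ q) / ρ q * pt ρ q + pt w q from
        (hσt.add hwt).deriv,
      show px (fun q' => σ (ρ q') + w q') q = η (ρ q) / ρ q * px ρ q + px w q from
        (hσx.add hwx).deriv, hρt_eq, hwt_eq]
    field_simp
    ring
  · rw [show pt (fun q' => σ (ρ q') - w q') q = η (ρ q) / ρ q * pt ρ q - pt w q from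
        (hσt.sub hwt).deriv,
      show px (fun q' => σ (ρ q') - w q') q = η (ρ q) / ρ q * px ρ q - px w q from
        (hσx.sub hwx).deriv, hρt_eq, hwt_eq]
    field_simp
    ring
end
end

section
/- Linearization of the shock-intersection map (choice of characteristic coordinates): Let 0 < a < 1, δ > 0, and let f : [0, δ] → ℝ be C² with f(0) = 0, f′(0) = a, and 0 < f(v) < v for all v ∈ (0, δ]. Then there exist ε* ∈ (0, δ] and a continuous, strictly increasing function φ : [0, ε*] → [0, δ] with φ(0) = 0 such that φ(a x) = f(φ(x)) for all x ∈ [0, ε*]. -/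
open Set

/-- An increasing continuous self-map of `[0, r]` fixing `0` and lying strictly below the identity
elsewhere. -/
structure IsDescending (h : ℝ → ℝ) (r : ℝ) : Prop where
  continuousOn : ContinuousOn h (Icc 0 r)
  strictMonoOn : StrictMonoOn h (Icc 0 r)
  map_zero : h 0 = 0
  lt_self : ∀ v ∈ Ioc (0 : ℝ) r, h v < v

namespace IsDescending

variable {h : ℝ → ℝ} {r : ℝ}

theorem pos (H : IsDescending h r) {v : ℝ} (hv : v ∈ Ioc 0 r) : 0 < h v := by
  have := H.strictMonoOn ⟨le_rfl, hv.1.le.trans hv.2⟩ ⟨hv.1.le, hv.2⟩ hv.1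
  rwa [H.map_zero] at this

theorem mapsTo (H : IsDescending h r) : MapsTo h (Icc 0 r) (Icc 0 r) := by
  intro v hv
  rcases hv.1.eq_or_lt with rfl | h0
  · rw [H.map_zero]; exact hv
  · exact ⟨(H.pos ⟨h0, hv.2⟩).le, (H.lt_self v ⟨h0, hv.2⟩).le.trans hv.2⟩

theorem mapsTo_Ioc (H : IsDescending h r) : MapsTo h (Ioc 0 r) (Ioc 0 r) :=
  fun v hv => ⟨H.pos hv, (H.lt_self v hv).le.trans hv.2⟩

theorem continuousOn_iterate (H : IsDescending h r) (n : ℕ) :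
    ContinuousOn h^[n] (Icc 0 r) :=
  H.continuousOn.iterate H.mapsTo n

theorem strictMonoOn_iterate (H : IsDescending h r) (n : ℕ) :
    StrictMonoOn h^[n] (Icc 0 r) := by
  induction n with
  | zero => exact strictMono_id.strictMonoOn _
  | succ n ih => exact ih.comp H.strictMonoOn H.mapsTo

theorem fundamental_subset (H : IsDescending h r) (hr : 0 < r) : Ioc (h r) r ⊆ Ioc 0 r :=
  Ioc_subset_Ioc_left (H.pos ⟨hr, le_rfl⟩).le

theorem antitone_iterate (H : IsDescending h r) (hr : 0 < r) :
    Antitone fun n => h^[n] r := by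
  refine antitone_nat_of_succ_le fun n => ?_
  rw [Function.iterate_succ_apply']
  exact (H.lt_self _ (H.mapsTo_Ioc.iterate n ⟨hr, le_rfl⟩)).le

theorem tendsto_iterate (H : IsDescending h r) (hr : 0 < r) :
    Filter.Tendsto (fun n => h^[n] r) Filter.atTop (nhds 0) := by
  have hmem : ∀ n, h^[n] r ∈ Icc 0 r := fun n => H.mapsTo.iterate n ⟨hr.le, le_rfl⟩
  have hlim := tendsto_atTop_ciInf (H.antitone_iterate hr)
    ⟨0, by rintro _ ⟨n, rfl⟩; exact (hmem n).1⟩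
  set l := ⨅ n, h^[n] r
  have hl : l ∈ Icc 0 r := isClosed_Icc.mem_of_tendsto hlim (Filter.Eventually.of_forall hmem)
  have hfix : h l = l := by
    have h1 := (H.continuousOn l hl).tendsto.comp
      (tendsto_nhdsWithin_iff.2 ⟨hlim, Filter.Eventually.of_forall hmem⟩)
    have h2 := hlim.comp (Filter.tendsto_add_atTop_nat 1)
    refine tendsto_nhds_unique h1 (h2.congr fun n => ?_)
    exact Function.iterate_succ_apply' h n r
  rcases hl.1.eq_or_lt with h0 | h0
  · rwa [← h0] at hlim
  · exact absurd hfix (H.lt_self l ⟨h0, hl.2⟩).ne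

/-- The iterates of the fundamental domain `(h r, r]` cover `(0, r]`. -/
theorem exists_iterate_eq (H : IsDescending h r) (hr : 0 < r) {y : ℝ} (hy : y ∈ Ioc 0 r) :
    ∃ n : ℕ, ∃ t ∈ Ioc (h r) r, h^[n] t = y := by
  classical
  have hex : ∃ n, h^[n + 1] r < y :=
    (((Filter.tendsto_add_atTop_iff_nat 1).2 (H.tendsto_iterate hr)).eventually_lt_const hy.1).exists
  have hlt := Nat.find_spec hex
  have hle : y ≤ h^[Nat.find hex] r := by
    rcases hn : Nat.find hex with _ | k
    · exact hy.2
    · exact not_lt.1 (Nat.find_min hex (by omega))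
  have hrr : r ∈ Ioc 0 r := ⟨hr, le_rfl⟩
  obtain ⟨t, ht, hty⟩ := intermediate_value_Ioc (H.lt_self r hrr).le
    ((H.continuousOn_iterate (Nat.find hex)).mono (Icc_subset_Icc_left (H.pos hrr).le)) ⟨hlt, hle⟩
  exact ⟨_, t, ht, hty⟩

theorem iterate_lt_iterate (H : IsDescending h r) (hr : 0 < r) {m n : ℕ} (hmn : m < n) {s t : ℝ}
    (hs : s ∈ Ioc (h r) r) (ht : t ∈ Ioc (h r) r) : h^[n] s < h^[m] t := by
  have hrI : r ∈ Icc 0 r := ⟨hr.le, le_rfl⟩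
  have hI := (H.fundamental_subset hr).trans Ioc_subset_Icc_self
  calc h^[n] s ≤ h^[n] r := (H.strictMonoOn_iterate n).monotoneOn (hI hs) hrI hs.2
    _ ≤ h^[m + 1] r := H.antitone_iterate hr hmn
    _ = h^[m] (h r) := rfl
    _ < h^[m] t := H.strictMonoOn_iterate m (H.mapsTo hrI) (hI ht) ht.1

theorem iterate_lt_iterate_iff (H : IsDescending h r) (hr : 0 < r) {m n : ℕ} {s t : ℝ}
    (hs : s ∈ Ioc (h r) r) (ht : t ∈ Ioc (h r) r) :
    h^[n] s < h^[m] t ↔ m < n ∨ m = n ∧ s < t := by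
  have hI := (H.fundamental_subset hr).trans Ioc_subset_Icc_self
  rcases lt_trichotomy m n with hmn | rfl | hmn
  · simp [hmn, H.iterate_lt_iterate hr hmn hs ht]
  · simpa using (H.strictMonoOn_iterate m).lt_iff_lt (hI hs) (hI ht)
  · simp [hmn.not_gt, hmn.ne', (H.iterate_lt_iterate hr hmn ht hs).le]

theorem iterate_injective (H : IsDescending h r) (hr : 0 < r) {m n : ℕ} {s t : ℝ}
    (hs : s ∈ Ioc (h r) r) (ht : t ∈ Ioc (h r) r) (heq : h^[n] s = h^[m] t) :
    n = m ∧ s = t := by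
  have h1 := mt (H.iterate_lt_iterate_iff hr hs ht).2 heq.not_lt
  have h2 := mt (H.iterate_lt_iterate_iff hr ht hs).2 heq.symm.not_lt
  push Not at h1 h2
  obtain rfl : n = m := le_antisymm h1.1 h2.1
  exact ⟨rfl, le_antisymm (h2.2 rfl) (h1.2 rfl)⟩

/-- Two descending maps of `[0, r]` are topologically conjugate. -/
theorem exists_conjugation {f : ℝ → ℝ} (H : IsDescending h r) (F : IsDescending f r)
    (hr : 0 < r) :
    ∃ φ : ℝ → ℝ, ContinuousOn φ (Icc 0 r) ∧ StrictMonoOn φ (Icc 0 r) ∧ φ 0 = 0 ∧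
      MapsTo φ (Icc 0 r) (Icc 0 r) ∧ ∀ x ∈ Icc 0 r, φ (h x) = f (φ x) := by
  have hrr : r ∈ Ioc 0 r := ⟨hr, le_rfl⟩
  have hc : 0 < (r - f r) / (r - h r) :=
    div_pos (sub_pos.2 (F.lt_self r hrr)) (sub_pos.2 (H.lt_self r hrr))
  obtain ⟨g, hg, hgm, hgs⟩ : ∃ g : ℝ → ℝ, StrictMono g ∧
      MapsTo g (Ioc (h r) r) (Ioc (f r) r) ∧ SurjOn g (Ioc (h r) r) (Ioc (f r) r) := by
    set c := (r - f r) / (r - h r)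
    have hcr : c * (r - h r) = r - f r := div_mul_cancel₀ _ (sub_pos.2 (H.lt_self r hrr)).ne'
    refine ⟨fun t => r - c * (r - t), fun s t hst => ?_, fun t ht => ⟨?_, ?_⟩, fun y hy => ?_⟩
    · have := mul_lt_mul_of_pos_left hst hc
      simp only
      linarith
    · have := mul_lt_mul_of_pos_left ht.1 hc
      simp only
      linarith
    · have := mul_nonneg hc.le (sub_nonneg.2 ht.2)
      simp only
      linarith
    · have hmul : c * ((r - y) / c) = r - y := mul_div_cancel₀ _ hc.ne'
      refine ⟨r - (r - y) / c, ⟨?_, ?_⟩, ?_⟩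
      · have : (r - y) / c < r - h r := by
          rw [div_lt_iff₀ hc]
          linarith [hy.1]
        linarith
      · have := div_nonneg (sub_nonneg.2 hy.2) hc.le
        linarith
      · simp only
        linarith
  choose! N T hT hNT using fun y (hy : y ∈ Ioc 0 r) => H.exists_iterate_eq hr hy
  set φ : ℝ → ℝ := fun x => if x = 0 then 0 else f^[N x] (g (T x))
  have hφ0 : φ 0 = 0 := if_pos rfl
  have hφ : ∀ n, ∀ t ∈ Ioc (h r) r, φ (h^[n] t) = f^[n] (g t) := by
    intro n t ht
    have hx := H.mapsTo_Ioc.iterate n (H.fundamental_subset hr ht)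
    obtain ⟨h1, h2⟩ := H.iterate_injective hr (hT _ hx) ht (hNT _ hx)
    simp only [φ, if_neg hx.1.ne', h1, h2]
  have hφpos : MapsTo φ (Ioc 0 r) (Ioc 0 r) := by
    intro x hx
    obtain ⟨n, t, ht, rfl⟩ := H.exists_iterate_eq hr hx
    rw [hφ n t ht]
    exact F.mapsTo_Ioc.iterate n (F.fundamental_subset hr (hgm ht))
  have hmaps : MapsTo φ (Icc 0 r) (Icc 0 r) := by
    intro x hx
    rcases hx.1.eq_or_lt with rfl | h0
    · rwa [hφ0]
    · exact Ioc_subset_Icc_self (hφpos ⟨h0, hx.2⟩)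
  have hmono : StrictMonoOn φ (Icc 0 r) := by
    intro x hx y hy hxy
    have hy' : y ∈ Ioc 0 r := ⟨hx.1.trans_lt hxy, hy.2⟩
    rcases hx.1.eq_or_lt with rfl | h0
    · rw [hφ0]
      exact (hφpos hy').1
    obtain ⟨n, s, hs, rfl⟩ := H.exists_iterate_eq hr ⟨h0, hx.2⟩
    obtain ⟨m, t, ht, rfl⟩ := H.exists_iterate_eq hr hy'
    rw [hφ n s hs, hφ m t ht, F.iterate_lt_iterate_iff hr (hgm hs) (hgm ht), hg.lt_iff_lt]
    exact (H.iterate_lt_iterate_iff hr hs ht).1 hxy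
  have hsurj : SurjOn φ (Icc 0 r) (Icc 0 r) := by
    intro y hy
    rcases hy.1.eq_or_lt with rfl | h0
    · exact ⟨0, hy, hφ0⟩
    obtain ⟨n, u, hu, rfl⟩ := F.exists_iterate_eq hr ⟨h0, hy.2⟩
    obtain ⟨t, ht, rfl⟩ := hgs hu
    exact ⟨h^[n] t, Ioc_subset_Icc_self (H.mapsTo_Ioc.iterate n (H.fundamental_subset hr ht)),
      hφ n t ht⟩
  refine ⟨φ, ?_, hmono, hφ0, hmaps, fun x hx => ?_⟩
  · have hcont : Continuous (hmaps.restrict φ _ _) :=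
      Monotone.continuous_of_surjective
        (fun x y hxy => hmono.monotoneOn x.2 y.2 hxy) (hmaps.restrict_surjective_iff.2 hsurj)
    exact continuousOn_iff_continuous_domRestrict.2 (continuous_subtype_val.comp hcont)
  · rcases hx.1.eq_or_lt with rfl | h0
    · rw [H.map_zero, hφ0, F.map_zero]
    obtain ⟨n, t, ht, rfl⟩ := H.exists_iterate_eq hr ⟨h0, hx.2⟩
    rw [← Function.iterate_succ_apply' h, hφ _ t ht, hφ _ t ht, Function.iterate_succ_apply']

end IsDescending

/-- A `C¹` function with positive derivative at the left endpoint is increasing nearby. -/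
theorem exists_strictMonoOn_of_derivWithin_pos {f : ℝ → ℝ} {δ : ℝ} (hδ : 0 < δ)
    (hf : ContDiffOn ℝ 1 f (Icc 0 δ)) (hpos : 0 < derivWithin f (Icc 0 δ) 0) :
    ∃ r, 0 < r ∧ r ≤ δ ∧ StrictMonoOn f (Icc 0 r) := by
  have hcont := hf.continuousOn_derivWithin (uniqueDiffOn_Icc hδ) le_rfl
  have hev := (hcont 0 ⟨le_rfl, hδ.le⟩).eventually_const_lt hpos
  rw [nhdsWithin_Icc_eq_nhdsGE hδ] at hev
  obtain ⟨u, hu, hsub⟩ := (mem_nhdsGE_iff_exists_Ico_subset' hδ).1 hev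
  refine ⟨min u δ, lt_min hu hδ, min_le_right _ _, ?_⟩
  refine strictMonoOn_of_deriv_pos (convex_Icc _ _)
    (hf.continuousOn.mono (Icc_subset_Icc_right (min_le_right _ _))) fun x hx => ?_
  rw [interior_Icc] at hx
  have hxu := hx.2.trans_le (min_le_left u δ)
  have hxδ := hx.2.trans_le (min_le_right u δ)
  rw [← derivWithin_of_mem_nhds (Icc_mem_nhds hx.1 hxδ)]
  exact hsub ⟨hx.1.le, hxu⟩

/-- **Linearization of the shock-intersection map (choice of characteristic coordinates).**
Let `0 < a < 1`, `δ > 0`, and let `f : [0, δ] → ℝ` be `C²` with `f(0) = 0`, `f′(0) = a`, and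
`0 < f(v) < v` for all `v ∈ (0, δ]`.  Then there exist `ε* ∈ (0, δ]` and a continuous, strictly
increasing function `φ : [0, ε*] → [0, δ]` with `φ(0) = 0` such that `φ(a·x) = f(φ(x))` for all
`x ∈ [0, ε*]`. -/
theorem conjugation_to_linear (a δ : ℝ) (ha₀ : 0 < a) (ha₁ : a < 1) (hδ : 0 < δ)
    (f : ℝ → ℝ) (hf : ContDiffOn ℝ 2 f (Icc 0 δ)) (hf0 : f 0 = 0)
    (hf'0 : derivWithin f (Icc 0 δ) 0 = a)
    (hfv : ∀ v ∈ Ioc (0 : ℝ) δ, 0 < f v ∧ f v < v) :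
    ∃ εs : ℝ, 0 < εs ∧ εs ≤ δ ∧
      ∃ φ : ℝ → ℝ,
        ContinuousOn φ (Icc 0 εs) ∧ StrictMonoOn φ (Icc 0 εs) ∧ φ 0 = 0 ∧
        MapsTo φ (Icc 0 εs) (Icc 0 δ) ∧
        ∀ x ∈ Icc (0 : ℝ) εs, φ (a * x) = f (φ x) := by
  obtain ⟨r, hr, hrδ, hmono⟩ := exists_strictMonoOn_of_derivWithin_pos hδ
    (hf.of_le one_le_two) (hf'0 ▸ ha₀)
  have F : IsDescending f r :=
    ⟨hf.continuousOn.mono (Icc_subset_Icc_right hrδ), hmono, hf0,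
      fun v hv => (hfv v ⟨hv.1, hv.2.trans hrδ⟩).2⟩
  have H : IsDescending (fun x => a * x) r :=
    ⟨by fun_prop, (strictMono_mul_left_of_pos ha₀).strictMonoOn _, mul_zero a,
      fun v hv => mul_lt_of_lt_one_left hv.1 ha₁⟩
  obtain ⟨φ, hc, hm, h0, hmaps, hconj⟩ := H.exists_conjugation F hr
  exact ⟨r, hr, hrδ, φ, hc, hm, h0, hmaps.mono_right (Icc_subset_Icc_right hrδ), hconj⟩
end

section
/- Mixed second derivative identity for the characteristic system: Let U ⊆ ℝ² be open, let c_in, c_out : U → ℝ be C¹ functions with c_in ≠ 0, c_out ≠ 0 and c_out ≠ c_in everywhere on U, and let t, x : U → ℝ be C² functions satisfying ∂x/∂u = c_in ∂t/∂u and ∂x/∂v = c_out ∂t/∂v on U. Then on U one has ∂²x/∂u∂v = μ ∂x/∂u + ν ∂x/∂v, where μ = (1/(c_out − c_in))·(c_out/c_in)·∂c_in/∂v and ν = −(1/(c_out − c_in))·(c_in/c_out)·∂c_out/∂u. -/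
noncomputable section

/-- Partial derivative with respect to the first coordinate `u`. -/
def pu (f : ℝ × ℝ → ℝ) (q : ℝ × ℝ) : ℝ := deriv (fun s => f (s, q.2)) q.1

/-- Partial derivative with respect to the second coordinate `v`. -/
def pv (f : ℝ × ℝ → ℝ) (q : ℝ × ℝ) : ℝ := deriv (fun s => f (q.1, s)) q.2

open Filter Topology

lemma pu_eq_fderiv {f : ℝ × ℝ → ℝ} {q : ℝ × ℝ} (hf : DifferentiableAt ℝ f q) :
    pu f q = fderiv ℝ f q (1, 0) :=
  (hf.hasFDerivAt.comp_hasDerivAt (f := fun s : ℝ => (s, q.2)) q.1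
    ((hasDerivAt_id q.1).prodMk (hasDerivAt_const q.1 q.2))).deriv

lemma pv_eq_fderiv {f : ℝ × ℝ → ℝ} {q : ℝ × ℝ} (hf : DifferentiableAt ℝ f q) :
    pv f q = fderiv ℝ f q (0, 1) :=
  (hf.hasFDerivAt.comp_hasDerivAt (f := fun s : ℝ => (q.1, s)) q.2
    ((hasDerivAt_const q.2 q.1).prodMk (hasDerivAt_id q.2))).deriv

lemma Filter.EventuallyEq.pu_eq {f g : ℝ × ℝ → ℝ} {q : ℝ × ℝ} (h : f =ᶠ[𝓝 q] g) :
    pu f q = pu g q :=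
  (h.comp_tendsto (Continuous.tendsto' (f := fun s : ℝ => (s, q.2)) (by fun_prop)
    q.1 q rfl)).deriv_eq

lemma Filter.EventuallyEq.pv_eq {f g : ℝ × ℝ → ℝ} {q : ℝ × ℝ} (h : f =ᶠ[𝓝 q] g) :
    pv f q = pv g q :=
  (h.comp_tendsto (Continuous.tendsto' (f := fun s : ℝ => (q.1, s)) (by fun_prop)
    q.2 q rfl)).deriv_eq

lemma pu_mul {f g : ℝ × ℝ → ℝ} {q : ℝ × ℝ} (hf : DifferentiableAt ℝ f q)
    (hg : DifferentiableAt ℝ g q) :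
    pu (fun p => f p * g p) q = pu f q * g q + f q * pu g q := by
  rw [pu_eq_fderiv (hf.fun_mul hg), pu_eq_fderiv hf, pu_eq_fderiv hg, fderiv_fun_mul hf hg]
  simp
  ring

lemma pv_mul {f g : ℝ × ℝ → ℝ} {q : ℝ × ℝ} (hf : DifferentiableAt ℝ f q)
    (hg : DifferentiableAt ℝ g q) :
    pv (fun p => f p * g p) q = pv f q * g q + f q * pv g q := by
  rw [pv_eq_fderiv (hf.fun_mul hg), pv_eq_fderiv hf, pv_eq_fderiv hg, fderiv_fun_mul hf hg]
  simp
  ring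

lemma ContDiffAt.eventually_differentiableAt {f : ℝ × ℝ → ℝ} {q : ℝ × ℝ}
    (hf : ContDiffAt ℝ 2 f q) : ∀ᶠ p in 𝓝 q, DifferentiableAt ℝ f p :=
  (hf.eventually (by simp)).mono fun _ hp => hp.differentiableAt (by simp)

lemma ContDiffAt.pu_eventuallyEq {f : ℝ × ℝ → ℝ} {q : ℝ × ℝ} (hf : ContDiffAt ℝ 2 f q) :
    pu f =ᶠ[𝓝 q] fun p => fderiv ℝ f p (1, 0) :=
  hf.eventually_differentiableAt.mono fun _ hp => pu_eq_fderiv hp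

lemma ContDiffAt.pv_eventuallyEq {f : ℝ × ℝ → ℝ} {q : ℝ × ℝ} (hf : ContDiffAt ℝ 2 f q) :
    pv f =ᶠ[𝓝 q] fun p => fderiv ℝ f p (0, 1) :=
  hf.eventually_differentiableAt.mono fun _ hp => pv_eq_fderiv hp

lemma ContDiffAt.differentiableAt_fderiv {f : ℝ × ℝ → ℝ} {q : ℝ × ℝ}
    (hf : ContDiffAt ℝ 2 f q) : DifferentiableAt ℝ (fderiv ℝ f) q :=
  (hf.fderiv_right (m := 1) (by norm_num)).differentiableAt (by simp)

lemma ContDiffAt.differentiableAt_pu {f : ℝ × ℝ → ℝ} {q : ℝ × ℝ} (hf : ContDiffAt ℝ 2 f q) :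
    DifferentiableAt ℝ (pu f) q :=
  (hf.differentiableAt_fderiv.clm_apply (differentiableAt_const _)).congr_of_eventuallyEq
    hf.pu_eventuallyEq

lemma ContDiffAt.differentiableAt_pv {f : ℝ × ℝ → ℝ} {q : ℝ × ℝ} (hf : ContDiffAt ℝ 2 f q) :
    DifferentiableAt ℝ (pv f) q :=
  (hf.differentiableAt_fderiv.clm_apply (differentiableAt_const _)).congr_of_eventuallyEq
    hf.pv_eventuallyEq

/-- Symmetry of the mixed second partial derivatives of a `C²` function. -/
lemma ContDiffAt.pu_pv_comm {f : ℝ × ℝ → ℝ} {q : ℝ × ℝ} (hf : ContDiffAt ℝ 2 f q) :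
    pu (pv f) q = pv (pu f) q := by
  have h := hf.differentiableAt_fderiv
  rw [pu_eq_fderiv hf.differentiableAt_pv, pv_eq_fderiv hf.differentiableAt_pu,
    hf.pv_eventuallyEq.fderiv_eq, hf.pu_eventuallyEq.fderiv_eq,
    fderiv_clm_apply h (differentiableAt_const _), fderiv_clm_apply h (differentiableAt_const _)]
  simpa using (hf.isSymmSndFDerivAt (by simp)) (1, 0) (0, 1)

/-- **Mixed second derivative identity for the characteristic system.**
Let `U ⊆ ℝ²` be open, `c_in, c_out : U → ℝ` be `C¹` with `c_in ≠ 0`, `c_out ≠ 0`,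
`c_out ≠ c_in` on `U`, and let `t, x : U → ℝ` be `C²` solutions of the characteristic system
`∂x/∂u = c_in ∂t/∂u`, `∂x/∂v = c_out ∂t/∂v` on `U`.  Then on `U`:
`∂²x/∂u∂v = μ ∂x/∂u + ν ∂x/∂v` with
`μ = (1/(c_out − c_in))·(c_out/c_in)·∂c_in/∂v` and
`ν = −(1/(c_out − c_in))·(c_in/c_out)·∂c_out/∂u`. -/
theorem mixed_second_derivative_identity (U : Set (ℝ × ℝ)) (hU : IsOpen U)
    (cin cout t x : ℝ × ℝ → ℝ)
    (hcin : ContDiffOn ℝ 1 cin U) (hcout : ContDiffOn ℝ 1 cout U)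
    (hcin0 : ∀ q ∈ U, cin q ≠ 0) (hcout0 : ∀ q ∈ U, cout q ≠ 0)
    (hne : ∀ q ∈ U, cout q ≠ cin q)
    (ht : ContDiffOn ℝ 2 t U) (hx : ContDiffOn ℝ 2 x U)
    (hchar₁ : ∀ q ∈ U, pu x q = cin q * pu t q)
    (hchar₂ : ∀ q ∈ U, pv x q = cout q * pv t q) :
    ∀ q ∈ U,
      pu (fun q' => pv x q') q =
        (1 / (cout q - cin q)) * (cout q / cin q) * pv cin q * pu x q
          + (-((1 / (cout q - cin q)) * (cin q / cout q) * pu cout q)) * pv x q := by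
  intro q hq
  have hUq : U ∈ 𝓝 q := hU.mem_nhds hq
  have hxq := hx.contDiffAt hUq
  have htq := ht.contDiffAt hUq
  have hcinq := (hcin.contDiffAt hUq).differentiableAt (by simp)
  have hcoutq := (hcout.contDiffAt hUq).differentiableAt (by simp)
  have hvu : pv (pu x) q = pv cin q * pu t q + cin q * pv (pu t) q :=
    (EventuallyEq.pv_eq (mem_of_superset hUq hchar₁)).trans
      (pv_mul hcinq htq.differentiableAt_pu)
  have huv : pu (pv x) q = pu cout q * pv t q + cout q * pu (pv t) q :=
    (EventuallyEq.pu_eq (mem_of_superset hUq hchar₂)).trans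
      (pu_mul hcoutq htq.differentiableAt_pv)
  rw [← hxq.pu_pv_comm, ← htq.pu_pv_comm] at hvu
  change pu (pv x) q = _
  rw [hchar₁ q hq, hchar₂ q hq]
  have h₁ := hcin0 q hq
  have h₂ := hcout0 q hq
  have h₃ : cout q - cin q ≠ 0 := sub_ne_zero.mpr (hne q hq)
  field_simp
  linear_combination cout q * hvu - cin q * huv
end
end

section
/- Local solvability of the jump conditions for the state behind: Suppose values β₀, α¹₋₀, β¹₋₀ satisfy J(β₀, β₀, α¹₋₀, β¹₋₀) = 0 with ρ(β₀,β₀) ≠ ρ(α¹₋₀,β¹₋₀), and suppose the associated shock speed V¹₀ = [ρw]/[ρ] satisfies V¹₀ ≠ η₀, where η₀ = η(ρ(β₀,β₀)) and w(β₀,β₀) = 0. Then ∂J/∂α₊(β₀, β₀, α¹₋₀, β¹₋₀) ≠ 0, and there exist a neighborhood of (β₀, α¹₋₀, β¹₋₀) in ℝ³ and a smooth function H¹ on it with H¹(β₀, α¹₋₀, β¹₋₀) = β₀ and J(H¹(β₊, α₋, β₋), β₊, α₋, β₋) = 0 throughout the neighborhood. Analogously, if β₀, α²₋₀, β²₋₀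 satisfy J(β₀, β₀, α²₋₀, β²₋₀) = 0 with distinct densities and associated shock speed V²₀ ≠ −η₀, then ∂J/∂β₊(β₀, β₀, α²₋₀, β²₋₀) ≠ 0 and there is a smooth H² near (β₀, α²₋₀, β²₋₀) with H²(β₀, α²₋₀, β²₋₀) = β₀ and J(α₊, H²(α₊, α₋, β₋), α₋, β₋) = 0. -/
noncomputable section

open Set

/-- Density as a function of the Riemann invariants: `ρ(α,β) = R((α+β)/2)`. -/
def ρf (R : ℝ → ℝ) (α β : ℝ) : ℝ := R ((α + β) / 2)

/-- Velocity as a function of the Riemann invariants: `w(α,β) = (α−β)/2`. -/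
def wf (α β : ℝ) : ℝ := (α - β) / 2

/-- The jump function
`J(α₊,β₊,α₋,β₋) = [ρw]² − [ρw² + p(ρ)]·[ρ]`, expressed through `ρ(α,β)` and `w(α,β)`. -/
def Jf (p R : ℝ → ℝ) (ap bp am bm : ℝ) : ℝ :=
  (ρf R ap bp * wf ap bp - ρf R am bm * wf am bm) ^ 2 -
    (ρf R ap bp * wf ap bp ^ 2 + p (ρf R ap bp)
      - ρf R am bm * wf am bm ^ 2 - p (ρf R am bm)) * (ρf R ap bp - ρf R am bm)

/-- The shock speed `V = [ρw]/[ρ]` determined by the two states. -/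
def Vf (R : ℝ → ℝ) (ap bp am bm : ℝ) : ℝ :=
  (ρf R ap bp * wf ap bp - ρf R am bm * wf am bm) / (ρf R ap bp - ρf R am bm)

open Filter Topology

/-- Smooth implicit function theorem for a scalar unknown, with smoothness and the equation both
holding on a common open set. -/
theorem exists_contDiffOn_implicit {E : Type*} [NormedAddCommGroup E] [NormedSpace ℝ E]
    [CompleteSpace E] {f : E × ℝ → ℝ} {n : WithTop ℕ∞} (hf : ContDiff ℝ n f) (hn : n ≠ 0)
    {u : E × ℝ} (hu : deriv (fun s => f (u.1, s)) u.2 ≠ 0) :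
    ∃ U : Set E, IsOpen U ∧ u.1 ∈ U ∧ ∃ ψ : E → ℝ, ContDiffOn ℝ n ψ U ∧ ψ u.1 = u.2 ∧
      ∀ x ∈ U, f (x, ψ x) = f u := by
  have partial_eq (v : E × ℝ) :
      deriv (fun s => f (v.1, s)) v.2 = fderiv ℝ f v (0, 1) :=
    ((hf.differentiable hn v).hasFDerivAt.comp_hasDerivAt v.2
      ((hasDerivAt_const v.2 v.1).prodMk (hasDerivAt_id v.2))).deriv
  have invertible {v : E × ℝ} (hv : fderiv ℝ f v (0, 1) ≠ 0) :
      (fderiv ℝ f v ∘L .inr ℝ E ℝ).IsInvertible := by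
    refine ⟨ContinuousLinearEquiv.unitsEquivAut ℝ (Units.mk0 _ hv), ?_⟩
    ext
    simp
  rw [partial_eq] at hu
  have hfu : ContDiffAt ℝ n f u := hf.contDiffAt
  set ψ := hfu.implicitFunction hn (invertible hu)
  have hψu : ψ u.1 = u.2 := hfu.implicitFunction_apply_self hn (invertible hu)
  have hψ : ContDiffAt ℝ n ψ u.1 := hfu.contDiffAt_implicitFunction hn (invertible hu)
  have hsol : ∀ᶠ x in 𝓝 u.1, f (x, ψ x) = f u :=
    hfu.eventually_apply_implicitFunction hn (invertible hu)
  have hcont : ∀ᶠ x in 𝓝 u.1, ContinuousAt ψ x :=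
    ((hψ.of_le (ENat.one_le_iff_ne_zero_withTop.2 hn)).eventually (by simp)).mono
      fun x hx => hx.continuousAt
  have hreg : ∀ᶠ x in 𝓝 u.1, fderiv ℝ f (x, ψ x) (0, 1) ≠ 0 := by
    have hc : ContinuousAt (fun x => fderiv ℝ f (x, ψ x) (0, 1)) u.1 :=
      (((hf.continuous_fderiv hn).clm_apply continuous_const).continuousAt).comp
        (continuousAt_id.prodMk hψ.continuousAt)
    refine hc.eventually_ne ?_
    simpa only [hψu] using hu
  obtain ⟨U, hU, hUo, huU⟩ := eventually_nhds_iff.1 (hsol.and (hcont.and hreg))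
  refine ⟨U, hUo, huU, ψ, fun x hx => ContDiffAt.contDiffWithinAt ?_, hψu, fun x hx => (hU x hx).1⟩
  obtain ⟨hx_sol, hx_cont, hx_reg⟩ := hU x hx
  have hfx : ContDiffAt ℝ n f (x, ψ x) := hf.contDiffAt
  refine (hfx.contDiffAt_implicitFunction hn (invertible hx_reg)).congr_of_eventuallyEq ?_
  filter_upwards [(continuousAt_id.prodMk hx_cont).eventually
    (hfx.eventually_apply_eq_iff_implicitFunction hn (invertible hx_reg)), hUo.mem_nhds hx]
    with y hy hyU
  exact (hy.1 ((hU y hyU).1.trans hx_sol.symm)).symm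

/-- Reflection `w ↦ -w` exchanges the Riemann invariants and preserves the jump function. -/
theorem Jf_swap (p R : ℝ → ℝ) (ap bp am bm : ℝ) : Jf p R bp ap bm am = Jf p R ap bp am bm := by
  simp only [Jf, ρf, wf, add_comm bp, add_comm bm]
  ring

/-- Reflection `w ↦ -w` reverses the shock speed. -/
theorem Vf_swap (R : ℝ → ℝ) (ap bp am bm : ℝ) : Vf R bp ap bm am = -Vf R ap bp am bm := by
  simp only [Vf, ρf, wf, add_comm bp, add_comm bm]
  ring

theorem contDiff_Jf {p R : ℝ → ℝ} {n : WithTop ℕ∞} (hp : ContDiffOn ℝ n p (Ioi 0))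
    (hR : ContDiff ℝ n R) (hRpos : ∀ s, 0 < R s) :
    ContDiff ℝ n (fun v : (ℝ × ℝ × ℝ) × ℝ => Jf p R v.2 v.1.1 v.1.2.1 v.1.2.2) := by
  have hpR : ContDiff ℝ n (fun s => p (R s)) := hp.comp_contDiff hR hRpos
  have hρ : ContDiff ℝ n (fun v : ℝ × ℝ => ρf R v.1 v.2) := by
    unfold ρf
    fun_prop
  have hpρ : ContDiff ℝ n (fun v : ℝ × ℝ => p (ρf R v.1 v.2)) :=
    hpR.comp (f := fun v : ℝ × ℝ => (v.1 + v.2) / 2) (by fun_prop)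
  have hw : ContDiff ℝ n (fun v : ℝ × ℝ => wf v.1 v.2) := by
    unfold wf
    fun_prop
  have hplus : ContDiff ℝ n (fun v : (ℝ × ℝ × ℝ) × ℝ => (v.2, v.1.1)) := by fun_prop
  have hminus : ContDiff ℝ n (fun v : (ℝ × ℝ × ℝ) × ℝ => (v.1.2.1, v.1.2.2)) := by fun_prop
  have hρp := hρ.comp hplus
  have hρm := hρ.comp hminus
  have hwp := hw.comp hplus
  have hwm := hw.comp hminus
  exact (((hρp.mul hwp).sub (hρm.mul hwm)).pow 2).sub
    (((((hρp.mul (hwp.pow 2)).add (hpρ.comp hplus)).sub (hρm.mul (hwm.pow 2))).sub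
      (hpρ.comp hminus)).mul (hρp.sub hρm))

/-- When the jump condition holds and the state ahead is at rest,
`∂J/∂α₊ = -(ρ₊ [ρ] / (2η)) (V - η)²`. -/
theorem hasDerivAt_Jf {p R : ℝ → ℝ} {c b am bm : ℝ}
    (hc : c ≠ 0) (hp : HasDerivAt p (c ^ 2) (R b)) (hR : HasDerivAt R (R b / c) b)
    (hJ : Jf p R b b am bm = 0) (hne : ρf R b b ≠ ρf R am bm) :
    HasDerivAt (fun s => Jf p R s b am bm)
      (-(R b * (ρf R b b - ρf R am bm) / (2 * c)) * (Vf R b b am bm - c) ^ 2) b := by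
  have hmid : (b + b) / 2 = b := by ring
  have hρ : HasDerivAt (fun s => ρf R s b) (R b / c * (1 / 2)) b := by
    refine HasDerivAt.comp (h₂ := R) b ?_ (((hasDerivAt_id b).add_const b).div_const 2)
    simpa only [id, hmid] using hR
  have hρb : ρf R b b = R b := by rw [ρf, hmid]
  have hw : HasDerivAt (fun s => wf s b) (1 / 2) b :=
    ((hasDerivAt_id b).sub_const b).div_const 2
  have hwb : wf b b = 0 := by simp [wf]
  have hpρ : HasDerivAt (fun s => p (ρf R s b)) (c ^ 2 * (R b / c * (1 / 2))) b :=
    HasDerivAt.comp (h₂ := p) b (by rwa [hρb]) hρ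
  have hder := (((hρ.mul hw).sub_const (ρf R am bm * wf am bm)).pow 2).sub
    (((((hρ.mul (hw.pow 2)).add hpρ).sub_const (ρf R am bm * wf am bm ^ 2)).sub_const
      (p (ρf R am bm))).mul (hρ.sub_const (ρf R am bm)))
  refine hder.congr_deriv ?_
  simp only [Jf, hρb, hwb] at hJ
  rw [hρb] at hne
  have hd : R b - ρf R am bm ≠ 0 := sub_ne_zero.2 hne
  simp only [Vf, Pi.mul_apply, Pi.add_apply, Pi.pow_apply, hρb, hwb]
  generalize ρf R am bm = r at *
  generalize wf am bm = w at *
  field_simp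
  push_cast
  linear_combination R b * hJ

/-- Local solvability for the first Riemann invariant behind the shock. -/
theorem exists_implicit_Jf {p η R : ℝ → ℝ}
    (hp : ContDiffOn ℝ (⊤ : ℕ∞) p (Ioi 0)) (hp' : ∀ r > (0 : ℝ), 0 < deriv p r)
    (hη : ∀ r > (0 : ℝ), η r = Real.sqrt (deriv p r))
    (hR : ContDiff ℝ (⊤ : ℕ∞) R) (hRpos : ∀ s, 0 < R s)
    (hR' : ∀ s, HasDerivAt R (R s / η (R s)) s) {b am bm : ℝ}
    (hJ : Jf p R b b am bm = 0) (hne : ρf R b b ≠ ρf R am bm)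
    (hV : Vf R b b am bm ≠ η (ρf R b b)) :
    deriv (fun s => Jf p R s b am bm) b ≠ 0 ∧
      ∃ U : Set (ℝ × ℝ × ℝ), IsOpen U ∧ (b, am, bm) ∈ U ∧
        ∃ H : ℝ × ℝ × ℝ → ℝ, ContDiffOn ℝ (⊤ : ℕ∞) H U ∧ H (b, am, bm) = b ∧
          ∀ y ∈ U, Jf p R (H y) y.1 y.2.1 y.2.2 = 0 := by
  have hr := hRpos b
  have hηpos : 0 < η (R b) := by
    rw [hη _ hr]
    exact Real.sqrt_pos.2 (hp' _ hr)
  have hpd : HasDerivAt p (η (R b) ^ 2) (R b) := by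
    rw [hη _ hr, Real.sq_sqrt (hp' _ hr).le]
    exact ((hp.contDiffAt (Ioi_mem_nhds hr)).differentiableAt (by simp)).hasDerivAt
  have hρb : ρf R b b = R b := by simp [ρf]
  have hder : deriv (fun s => Jf p R s b am bm) b ≠ 0 := by
    rw [(hasDerivAt_Jf hηpos.ne' hpd (hR' b) hJ hne).deriv]
    rw [hρb] at hV
    exact mul_ne_zero (neg_ne_zero.2 (div_ne_zero (mul_ne_zero hr.ne' (sub_ne_zero.2 hne))
      (mul_ne_zero two_ne_zero hηpos.ne'))) (pow_ne_zero 2 (sub_ne_zero.2 hV))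
  obtain ⟨U, hU, hmem, H, hH, hHb, hsol⟩ :=
    exists_contDiffOn_implicit (contDiff_Jf hp hR hRpos) (by simp) (u := ((b, am, bm), b)) hder
  exact ⟨hder, U, hU, hmem, H, hH, hHb, fun y hy => (hsol y hy).trans hJ⟩

/-- **Local solvability of the jump conditions for the state behind.**
If `J(β₀, β₀, α¹₋₀, β¹₋₀) = 0` with distinct densities and associated shock speed
`V¹₀ ≠ η₀`, then `∂J/∂α₊ ≠ 0` there and the jump condition can be solved smoothly for the
Riemann invariant `α₊` behind the left shock near the data (implicit function `H¹`);
analogously, if `J(β₀, β₀, α²₋₀, β²₋₀) = 0` with distinct densities and `V²₀ ≠ −η₀`, then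
`∂J/∂β₊ ≠ 0` there and the jump condition can be solved smoothly for `β₊` behind the right
shock (implicit function `H²`). -/
theorem jump_conditions_locally_solvable
    (p η R : ℝ → ℝ)
    (hp : ContDiffOn ℝ (⊤ : ℕ∞) p (Ioi 0))
    (hp' : ∀ r > (0 : ℝ), 0 < deriv p r)
    (hη : ∀ r > (0 : ℝ), η r = Real.sqrt (deriv p r))
    (hR : ContDiff ℝ (⊤ : ℕ∞) R) (hRpos : ∀ s, 0 < R s)
    (hR' : ∀ s, HasDerivAt R (R s / η (R s)) s)
    (β₀ αm₁ βm₁ αm₂ βm₂ : ℝ)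
    (hJ₁ : Jf p R β₀ β₀ αm₁ βm₁ = 0)
    (hne₁ : ρf R β₀ β₀ ≠ ρf R αm₁ βm₁)
    (hV₁ : Vf R β₀ β₀ αm₁ βm₁ ≠ η (ρf R β₀ β₀))
    (hJ₂ : Jf p R β₀ β₀ αm₂ βm₂ = 0)
    (hne₂ : ρf R β₀ β₀ ≠ ρf R αm₂ βm₂)
    (hV₂ : Vf R β₀ β₀ αm₂ βm₂ ≠ -η (ρf R β₀ β₀)) :
    (deriv (fun s => Jf p R s β₀ αm₁ βm₁) β₀ ≠ 0 ∧
      ∃ U : Set (ℝ × ℝ × ℝ), IsOpen U ∧ (β₀, αm₁, βm₁) ∈ U ∧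
        ∃ H₁ : ℝ × ℝ × ℝ → ℝ, ContDiffOn ℝ (⊤ : ℕ∞) H₁ U ∧
          H₁ (β₀, αm₁, βm₁) = β₀ ∧
          ∀ y ∈ U, Jf p R (H₁ y) y.1 y.2.1 y.2.2 = 0) ∧
    (deriv (fun s => Jf p R β₀ s αm₂ βm₂) β₀ ≠ 0 ∧
      ∃ U : Set (ℝ × ℝ × ℝ), IsOpen U ∧ (β₀, αm₂, βm₂) ∈ U ∧
        ∃ H₂ : ℝ × ℝ × ℝ → ℝ, ContDiffOn ℝ (⊤ : ℕ∞) H₂ U ∧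
          H₂ (β₀, αm₂, βm₂) = β₀ ∧
          ∀ y ∈ U, Jf p R y.1 (H₂ y) y.2.1 y.2.2 = 0) := by
  refine ⟨exists_implicit_Jf hp hp' hη hR hRpos hR' hJ₁ hne₁ hV₁, ?_⟩
  obtain ⟨hder, U, hU, hmem, H, hH, hHb, hsol⟩ :=
    exists_implicit_Jf hp hp' hη hR hRpos hR' (b := β₀) (am := βm₂) (bm := αm₂)
      (by rwa [Jf_swap]) (by simpa only [ρf, add_comm βm₂] using hne₂)
      (by rwa [Vf_swap, Ne, neg_eq_iff_eq_neg])
  have hswap : ContDiff ℝ (⊤ : ℕ∞) (fun y : ℝ × ℝ × ℝ => (y.1, y.2.2, y.2.1)) := by fun_prop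
  refine ⟨by simpa only [Jf_swap p R β₀ _ αm₂ βm₂] using hder, _,
    hU.preimage hswap.continuous, hmem, _, hH.comp hswap.contDiffOn fun _ hy => hy, hHb,
    fun y hy => ?_⟩
  rw [← Jf_swap]
  exact hsol _ hy
end
end

section
/- Smallness of the eigenvalues of the difference-estimate matrix: Let 0 < a < 1, 0 < k < 1 and F₁, F₂ > 0 with F₁·F₂ = a², and let C₁, …, C₇ ≥ 0 be arbitrary constants. Then for ε > 0 sufficiently small, every (complex) eigenvalue λ of the 3×3 matrix with rows (C₁ε, F₁ + C₂ε, C₃), (a²F₂ + C₄ε, C₅ε, C₆), (C₇ε, C₇ε, k) satisfies |λ| < 1. -/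
/-- A weighted maximum principle: if the entrywise norms of `A` strictly contract some positive
vector `w`, then every eigenvalue of `A` has norm less than one. -/
theorem norm_lt_one_of_mem_spectrum_of_sum_norm_mul_lt {n : Type*} [Fintype n] [DecidableEq n]
    {A : Matrix n n ℂ} {w : n → ℝ} (hw : ∀ i, 0 < w i)
    (hA : ∀ i, ∑ j, ‖A i j‖ * w j < w i) {lam : ℂ} (hlam : lam ∈ spectrum ℂ A) :
    ‖lam‖ < 1 := by
  rw [← Matrix.spectrum_toLin', ← Module.End.hasEigenvalue_iff_mem_spectrum] at hlam
  obtain ⟨v, hv⟩ := hlam.exists_hasEigenvector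
  have hAv (i : n) : ∑ j, A i j * v j = lam * v i := by
    simpa [Matrix.mulVec, dotProduct] using congrFun hv.apply_eq_smul i
  obtain ⟨l, hl⟩ := Function.ne_iff.mp hv.2
  obtain ⟨i, -, hi⟩ := Finset.exists_max_image Finset.univ (fun j => ‖v j‖ / w j)
    ⟨l, Finset.mem_univ l⟩
  set m := ‖v i‖ / w i with hm
  have hm_pos : 0 < m :=
    (div_pos (norm_pos_iff.mpr hl) (hw l)).trans_le (hi l (Finset.mem_univ l))
  have hvi : ‖v i‖ = m * w i := by rw [hm, div_mul_cancel₀ _ (hw i).ne']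
  have hv_le (j : n) : ‖v j‖ ≤ m * w j := (div_le_iff₀ (hw j)).mp (hi j (Finset.mem_univ j))
  have key : ‖lam‖ * (m * w i) < 1 * (m * w i) := by
    calc ‖lam‖ * (m * w i) = ‖∑ j, A i j * v j‖ := by rw [hAv, norm_mul, hvi]
      _ ≤ ∑ j, ‖A i j * v j‖ := norm_sum_le _ _
      _ ≤ ∑ j, m * (‖A i j‖ * w j) := by
        refine Finset.sum_le_sum fun j _ => ?_
        rw [norm_mul, mul_left_comm]
        exact mul_le_mul_of_nonneg_left (hv_le j) (norm_nonneg _)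
      _ = m * ∑ j, ‖A i j‖ * w j := by rw [Finset.mul_sum]
      _ < m * w i := mul_lt_mul_of_pos_left (hA i) hm_pos
      _ = 1 * (m * w i) := (one_mul _).symm
  exact lt_of_mul_lt_mul_right key (mul_pos hm_pos (hw i)).le

/-- **Smallness of the eigenvalues of the difference-estimate matrix.**
Let `0 < a < 1`, `0 < k < 1` and `F₁, F₂ > 0` with `F₁·F₂ = a²`, and let `C₁, …, C₇ ≥ 0`.
Then for `ε > 0` sufficiently small, every complex eigenvalue `λ` of the matrix with rows
`(C₁ε, F₁ + C₂ε, C₃)`, `(a²F₂ + C₄ε, C₅ε, C₆)`, `(C₇ε, C₇ε, k)` satisfies `|λ| < 1`. -/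
theorem eigenvalues_lt_one (a k F₁ F₂ C₁ C₂ C₃ C₄ C₅ C₆ C₇ : ℝ)
    (ha₀ : 0 < a) (ha₁ : a < 1) (hk₀ : 0 < k) (hk₁ : k < 1)
    (hF₁ : 0 < F₁) (hF₂ : 0 < F₂) (hFF : F₁ * F₂ = a ^ 2)
    (hC₁ : 0 ≤ C₁) (hC₂ : 0 ≤ C₂) (hC₃ : 0 ≤ C₃) (hC₄ : 0 ≤ C₄)
    (hC₅ : 0 ≤ C₅) (hC₆ : 0 ≤ C₆) (hC₇ : 0 ≤ C₇) :
    ∃ ε₀ > (0 : ℝ), ∀ ε : ℝ, 0 < ε → ε ≤ ε₀ →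
      ∀ lam ∈ spectrum ℂ
          (!![((C₁ * ε : ℝ) : ℂ), ((F₁ + C₂ * ε : ℝ) : ℂ), ((C₃ : ℝ) : ℂ);
              ((a ^ 2 * F₂ + C₄ * ε : ℝ) : ℂ), ((C₅ * ε : ℝ) : ℂ), ((C₆ : ℝ) : ℂ);
              ((C₇ * ε : ℝ) : ℂ), ((C₇ * ε : ℝ) : ℂ), ((k : ℝ) : ℂ)] :
            Matrix (Fin 3) (Fin 3) ℂ),
        ‖lam‖ < 1 := by
  have eventually_lt {f : ℝ → ℝ} {c : ℝ} (hf : Continuous f) (h : f 0 < c) :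
      ∀ᶠ x in nhds 0, f x < c := hf.continuousAt.eventually_lt continuousAt_const h
  have h₁ : F₁ * 1 < F₁ / a := by
    rw [lt_div_iff₀ ha₀]
    nlinarith
  have h₂ : a ^ 2 * F₂ * (F₁ / a) < 1 := by
    have : a ^ 2 * F₂ * (F₁ / a) = a ^ 3 := by
      field_simp
      linear_combination hFF
    rw [this]
    exact pow_lt_one₀ ha₀.le ha₁ (by norm_num)
  obtain ⟨δ, ⟨hδ₁, hδ₂⟩, hδ⟩ :=
    ((((eventually_lt (f := fun x => F₁ * 1 + C₃ * x) (by fun_prop) (by simpa using h₁)).and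
      (eventually_lt (f := fun x => a ^ 2 * F₂ * (F₁ / a) + C₆ * x) (by fun_prop)
        (by simpa using h₂))).filter_mono nhdsWithin_le_nhds).and
      (self_mem_nhdsWithin (s := Set.Ioi (0 : ℝ)))).exists
  have hε := (eventually_lt
      (f := fun x => C₁ * x * (F₁ / a) + (F₁ + C₂ * x) * 1 + C₃ * δ) (by fun_prop)
      (by simpa using hδ₁)).and <| (eventually_lt
      (f := fun x => (a ^ 2 * F₂ + C₄ * x) * (F₁ / a) + C₅ * x * 1 + C₆ * δ) (by fun_prop)
      (by simpa using hδ₂)).and <| eventually_lt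
      (f := fun x => C₇ * x * (F₁ / a) + C₇ * x * 1 + k * δ) (c := δ) (by fun_prop)
      (by simpa using mul_lt_of_lt_one_left hδ hk₁)
  obtain ⟨r, hr, hball⟩ := Metric.eventually_nhds_iff.mp hε
  refine ⟨r / 2, half_pos hr, fun ε hε₀ hε₁ lam hlam => ?_⟩
  obtain ⟨hr₁, hr₂, hr₃⟩ := hball (y := ε) (by
    rw [Real.dist_eq, sub_zero, abs_of_pos hε₀]
    linarith)
  have hnorm {x : ℝ} (hx : 0 ≤ x) : ‖(x : ℂ)‖ = x := Complex.norm_of_nonneg hx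
  refine norm_lt_one_of_mem_spectrum_of_sum_norm_mul_lt (w := ![F₁ / a, 1, δ]) ?_ ?_ hlam
  · intro i
    fin_cases i
    · exact div_pos hF₁ ha₀
    · exact one_pos
    · exact hδ
  · intro i
    rw [Fin.sum_univ_three]
    fin_cases i
    · change ‖((C₁ * ε : ℝ) : ℂ)‖ * (F₁ / a) + ‖((F₁ + C₂ * ε : ℝ) : ℂ)‖ * 1
        + ‖(C₃ : ℂ)‖ * δ < F₁ / a
      rwa [hnorm (by positivity), hnorm (by positivity), hnorm hC₃]
    · change ‖((a ^ 2 * F₂ + C₄ * ε : ℝ) : ℂ)‖ * (F₁ / a) + ‖((C₅ * ε : ℝ) : ℂ)‖ * 1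
        + ‖(C₆ : ℂ)‖ * δ < 1
      rwa [hnorm (by positivity), hnorm (by positivity), hnorm hC₆]
    · change ‖((C₇ * ε : ℝ) : ℂ)‖ * (F₁ / a) + ‖((C₇ * ε : ℝ) : ℂ)‖ * 1
        + ‖(k : ℂ)‖ * δ < δ
      rwa [hnorm (by positivity), hnorm hk₀.le]
end
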